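/- Theorem 1 (exact linear convergence of CC-DQM without censoring). Suppose the thresholds satisfy μ_k = 0 for all k, and the penalty parameter c > 0 and compressor parameter δ satisfy the parameter condition: there exists β > ℓ²/(2 c λ₂ v) with G(β) > 0 and δ/(1−√δ)² < G(β)/(3 c λₙ + 2 c β λₙ + c λₙ²/(β λ₂)), where G(β) = c λ̂₁/2 − 2 c β λ₂ ℓ²/(2 c β λ₂ v − ℓ²) − (c² λ̂ₙ² + 4ℓ²)/(c β λ₂). Then the stacked sequence x_k converges to x* at a linear rate: there exist σ ∈ (0,1) and C₀ ≥ 0 such that ‖x_k − x*‖ ≤ C₀ σ^k for all k ≥ 0. -/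

import Mathlib

open scoped RealInnerProductSpace BigOperators

noncomputable section

/-- Blockwise action of a matrix `A` on stacked vectors in `(ℝ^d)^n ≅ ℝ^{nd}`
(i.e. the action of `A ⊗ I_d`). -/
def blockMul {m n d : ℕ} (A : Matrix (Fin m) (Fin n) ℝ)
    (z : Fin n → EuclideanSpace ℝ (Fin d)) : Fin m → EuclideanSpace ℝ (Fin d) :=
  fun i => ∑ j, A i j • z j

/-- `t` is an eigenvalue of the real matrix `A`. -/
def IsEigenvalue {n : ℕ} (A : Matrix (Fin n) (Fin n) ℝ) (t : ℝ) : Prop :=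
  ∃ z : Fin n → ℝ, z ≠ 0 ∧ A.mulVec z = t • z

/-- The signed Laplacian `L = D - W` of a graph. -/
def signedLap {n : ℕ} (G : SimpleGraph (Fin n)) [DecidableRel G.Adj] :
    Matrix (Fin n) (Fin n) ℝ :=
  Matrix.diagonal (fun i => (G.degree i : ℝ)) - G.adjMatrix ℝ

/-- The unsigned Laplacian `L_s = D + W` of a graph. -/
def unsignedLap {n : ℕ} (G : SimpleGraph (Fin n)) [DecidableRel G.Adj] :
    Matrix (Fin n) (Fin n) ℝ :=
  Matrix.diagonal (fun i => (G.degree i : ℝ)) + G.adjMatrix ℝ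

/-- The CC-DQM iteration: initializations `y₀ = 0`, `φ₀ = 0`, the primal update
`x_{i,k+1} = x_{i,k} - (2 c dᵢ I + ∇²fᵢ(y_{i,k}))⁻¹ (∇fᵢ(x_{i,k}) + c Σ_{j ∈ Nᵢ} (y_{i,k} - y_{j,k}) + φ_{i,k})`,
the censored/compressed state update for `y`, and the dual update for `φ`. -/
def IsCCDQM {n d : ℕ} (G : SimpleGraph (Fin n)) [DecidableRel G.Adj]
    (f : Fin n → EuclideanSpace ℝ (Fin d) → ℝ) (c : ℝ) (μ : ℕ → ℝ)
    (C : EuclideanSpace ℝ (Fin d) → EuclideanSpace ℝ (Fin d))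
    (x y φ : ℕ → Fin n → EuclideanSpace ℝ (Fin d)) : Prop :=
  (∀ i, y 0 i = 0) ∧ (∀ i, φ 0 i = 0) ∧
  (∀ k i, x (k+1) i = x k i -
      Ring.inverse ((2 * c * (G.degree i : ℝ)) •
            (1 : EuclideanSpace ℝ (Fin d) →L[ℝ] EuclideanSpace ℝ (Fin d))
          + fderiv ℝ (gradient (f i)) (y k i))
        (gradient (f i) (x k i)
          + c • ∑ j ∈ G.neighborFinset i, (y k i - y k j) + φ k i)) ∧
  (∀ k i, y (k+1) i =
      if μ (k+1) ≤ ‖x (k+1) i - y k i‖ then y k i + C (x (k+1) i - y k i) else y k i) ∧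
  (∀ k i, φ (k+1) i = φ k i + c • ∑ j ∈ G.neighborFinset i, (y (k+1) i - y (k+1) j))

theorem LinearMap.IsSymmetric.quadratic_form_nonneg {E : Type*} [NormedAddCommGroup E]
    [InnerProductSpace ℝ E] [FiniteDimensional ℝ E] {T : E →ₗ[ℝ] E} (hT : T.IsSymmetric)
    {a b g : ℝ} (h : ∀ t, Module.End.HasEigenvalue T t → 0 ≤ a * t ^ 2 + b * t + g) (z : E) :
    0 ≤ a * ‖T z‖ ^ 2 + b * ⟪z, T z⟫ + g * ‖z‖ ^ 2 := by
  set u := hT.eigenvectorBasis rfl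
  have key : ∀ i, ⟪u i, T z⟫ = hT.eigenvalues rfl i * ⟪u i, z⟫ := fun i => by
    rw [← hT (u i) z, hT.apply_eigenvectorBasis rfl i, real_inner_smul_left]
    rfl
  have h1 : ‖T z‖ ^ 2 = ∑ i, hT.eigenvalues rfl i ^ 2 * ⟪u i, z⟫ ^ 2 := by
    rw [← u.sum_sq_inner_right (T z)]
    exact Finset.sum_congr rfl fun i _ => by rw [key]; ring
  have h2 : ⟪z, T z⟫ = ∑ i, hT.eigenvalues rfl i * ⟪u i, z⟫ ^ 2 := by
    rw [← u.sum_inner_mul_inner z (T z)]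
    exact Finset.sum_congr rfl fun i _ => by rw [key, real_inner_comm z]; ring
  rw [h1, h2, ← u.sum_sq_inner_right z, Finset.mul_sum, Finset.mul_sum, Finset.mul_sum,
    ← Finset.sum_add_distrib, ← Finset.sum_add_distrib]
  refine Finset.sum_nonneg fun i _ => ?_
  have := mul_nonneg (h _ (hT.hasEigenvalue_eigenvalues rfl i)) (sq_nonneg ⟪u i, z⟫)
  simp only [RCLike.ofReal_real_eq_id, _root_.id] at this
  linarith

/-- Weighted Cauchy-Schwarz with weights `1/4, 1/8, 1/8, 1/2`. -/
theorem sq_add_add_add_le (a b c d : ℝ) :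
    (a + b + c + d) ^ 2 ≤ 4 * a ^ 2 + 8 * b ^ 2 + 8 * c ^ 2 + 2 * d ^ 2 := by
  nlinarith [sq_nonneg (a - 2 * b), sq_nonneg (a - 2 * c), sq_nonneg (2 * a - d),
    sq_nonneg (b - c), sq_nonneg (4 * b - d), sq_nonneg (4 * c - d)]

/-- A nonnegative sequence with `W (k+1) ≤ W k - r W (k+1)`, `r > 0`, decays geometrically. -/
theorem le_mul_inv_pow_of_succ_le {W : ℕ → ℝ} {r : ℝ} (hr : 0 < r)
    (h : ∀ k, W (k + 1) ≤ W k - r * W (k + 1)) (k : ℕ) : W k ≤ W 0 * ((1 + r)⁻¹) ^ k := by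
  induction k with
  | zero => simp
  | succ k ih =>
    have h1 : W (k + 1) ≤ W k * (1 + r)⁻¹ := by
      rw [← div_eq_mul_inv, le_div_iff₀ (by linarith)]
      linarith [h k]
    calc W (k + 1) ≤ W k * (1 + r)⁻¹ := h1
      _ ≤ W 0 * ((1 + r)⁻¹) ^ k * (1 + r)⁻¹ := by gcongr
      _ = _ := by ring

/-- `-a X² + 2 l X D - (l²/a) D²` is a negative square, so any extra `-g D²` gives coercivity. -/
theorem exists_coercive_bound {a g : ℝ} (l : ℝ) (ha : 0 < a) (hg : 0 < g) :
    ∃ η > 0, ∀ X D : ℝ, -a * X ^ 2 + 2 * l * X * D - l ^ 2 / a * D ^ 2 - g * D ^ 2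
      ≤ -η * (X ^ 2 + D ^ 2) := by
  have hm : 0 < 1 + 2 * (l / a) ^ 2 := by positivity
  refine ⟨min (a / 2) (g / (1 + 2 * (l / a) ^ 2)), by positivity, fun X D => ?_⟩
  set η := min (a / 2) (g / (1 + 2 * (l / a) ^ 2)) with hη
  have hη0 : 0 < η := by positivity
  have h1 : η ≤ a / 2 := min_le_left _ _
  have h2 : η * (1 + 2 * (l / a) ^ 2) ≤ g := by
    rw [← le_div_iff₀ hm]; exact min_le_right _ _
  obtain ⟨m, rfl⟩ : ∃ m, l = m * a := ⟨l / a, by field_simp⟩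
  have e1 : m * a / a = m := by field_simp
  have e2 : (m * a) ^ 2 / a = m ^ 2 * a := by field_simp
  rw [e1] at h2
  rw [e2]
  nlinarith [mul_nonneg (sub_nonneg.2 h1) (sq_nonneg (X - m * D)),
    mul_nonneg (sub_nonneg.2 h2) (sq_nonneg D),
    mul_nonneg hη0.le (sq_nonneg (X - 2 * m * D))]

/-- The one-step energy inequality of the inexact primal-dual iteration. -/
theorem primal_dual_energy_step {E : Type*} [NormedAddCommGroup E] [InnerProductSpace ℝ E]
    {L S : E →ₗ[ℝ] E} (hL : L.IsSymmetric) (hS : S.IsSymmetric)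
    (hLpos : ∀ z, 0 ≤ ⟪z, L z⟫) {c : ℝ} (hc : 0 < c) {X X' e e' q q' g w : E}
    (hq : q' = q + X' + e')
    (heq : g + c • L q' + c • S (X' - X) + w - c • L (e' - e) = 0) :
    c / 2 * ⟪q', L q'⟫ + c / 2 * ⟪X', S X'⟫ + c / 2 * ⟪e', L e'⟫ ≤
      c / 2 * ⟪q, L q⟫ + c / 2 * ⟪X, S X⟫ + c / 2 * ⟪e, L e⟫ - ⟪g, X'⟫ - ⟪w, X'⟫
        - c / 2 * ⟪X' - X, S (X' - X)⟫ + ⟪c • L q', e'⟫ := by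
  have h0 : ⟪g + c • L q' + c • S (X' - X) + w - c • L (e' - e), X'⟫ = 0 := by
    rw [heq, inner_zero_left]
  have hX : q = q' - X' - e' := by rw [hq]; abel
  have hp := mul_nonneg hc.le (hLpos (X' + e' - (e' - e)))
  have sL : ∀ u z, ⟪L u, z⟫ = ⟪z, L u⟫ := fun u z => real_inner_comm _ _
  have sS : ∀ u z, ⟪S u, z⟫ = ⟪z, S u⟫ := fun u z => real_inner_comm _ _
  have tL : ∀ u z, ⟪u, L z⟫ = ⟪z, L u⟫ := fun u z => by rw [← hL, sL]
  have tS : ∀ u z, ⟪u, S z⟫ = ⟪z, S u⟫ := fun u z => by rw [← hS, sS]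
  subst hX
  simp only [map_sub, map_add, inner_sub_left, inner_add_left, inner_sub_right, inner_add_right,
    real_inner_smul_left, smul_sub, sL, sS] at h0 hp ⊢
  rw [tL e' q', tL X' q', tL e' X', tS X' X] at *
  rw [tL e' e, tL X' e] at *
  linarith

/-- If the error contracts as `e' ≤ s (D + e)`, a weight `M` on `e²` absorbs `A e'² + B e²` at the
price of `(A + B) s² / (1 - s)² D²`. -/
theorem exists_error_weight {s A B : ℝ} (hs0 : 0 ≤ s) (hs1 : s < 1) (hA : 0 ≤ A) (hB : 0 ≤ B) :
    ∃ M ≥ 0, ∀ e e' D : ℝ, e' ^ 2 ≤ s ^ 2 * (D + e) ^ 2 →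
      A * e' ^ 2 + B * e ^ 2 + M * e' ^ 2 ≤ M * e ^ 2 + s ^ 2 / (1 - s) ^ 2 * (A + B) * D ^ 2 := by
  have h1 : 0 < 1 - s := sub_pos.2 hs1
  refine ⟨(B + s * A) / (1 - s), by positivity, fun e e' D h => ?_⟩
  have h2 : e' ^ 2 ≤ s ^ 2 / (1 - s) * D ^ 2 + s * e ^ 2 := by
    refine h.trans ?_
    have : s ^ 2 / (1 - s) * D ^ 2 + s * e ^ 2 - s ^ 2 * (D + e) ^ 2
        = s * (s * D - (1 - s) * e) ^ 2 / (1 - s) := by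
      field_simp; ring
    have : 0 ≤ s * (s * D - (1 - s) * e) ^ 2 / (1 - s) := by positivity
    linarith
  have h3 := mul_le_mul_of_nonneg_left h2 (show 0 ≤ (A + B) / (1 - s) by positivity)
  have e1 : A + (B + s * A) / (1 - s) = (A + B) / (1 - s) := by field_simp; ring
  have e2 : (B + s * A) / (1 - s) - B = s * ((A + B) / (1 - s)) := by field_simp; ring
  have e3 : s ^ 2 / (1 - s) ^ 2 * (A + B) = (A + B) / (1 - s) * (s ^ 2 / (1 - s)) := by field_simp
  rw [e3]
  have e4 := congrArg (· * e' ^ 2) e1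
  have e5 := congrArg (· * e ^ 2) e2
  beta_reduce at e4 e5
  linarith

theorem exists_dominating_const {K₁ K₂ K₃ η θ : ℝ} (hK₁ : 0 ≤ K₁) (hK₂ : 0 ≤ K₂) (hK₃ : 0 ≤ K₃)
    (hη : 0 < η) (hθ : 0 < θ) :
    ∃ K > 0, ∀ x y z : ℝ, 0 ≤ x → 0 ≤ y → 0 ≤ z →
      K₁ * x + K₂ * y + K₃ * z ≤ K * (η * (x + y) + θ * z) := by
  refine ⟨K₁ / η + K₂ / η + K₃ / θ + 1, by positivity, fun x y z hx hy hz => ?_⟩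
  have e1 : K₁ * x = K₁ / η * (η * x) := by field_simp
  have e2 : K₂ * y = K₂ / η * (η * y) := by field_simp
  have e3 : K₃ * z = K₃ / θ * (θ * z) := by field_simp
  have : 0 ≤ K₁ / η := by positivity
  have : 0 ≤ K₂ / η := by positivity
  have : 0 ≤ K₃ / θ := by positivity
  have : 0 ≤ η * x := by positivity
  have : 0 ≤ η * y := by positivity
  have : 0 ≤ θ * z := by positivity
  rw [e1, e2, e3, mul_add η]
  generalize K₁ / η = p₁, K₂ / η = p₂, K₃ / θ = p₃, η * x = X, η * y = Y, θ * z = Z at *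
  have : 0 ≤ p₁ * (Y + Z) + p₂ * (X + Z) + p₃ * (X + Y) := by positivity
  linarith

/-- The dual residual is controlled by the primal quantities. -/
theorem dual_residual_le {E : Type*} [NormedAddCommGroup E] [InnerProductSpace ℝ E]
    {L S : E →ₗ[ℝ] E} {lamn lhn c ℓ : ℝ} (hc : 0 ≤ c) (hlamn : 0 ≤ lamn)
    (hLub : ∀ z, ‖L z‖ ≤ lamn * ‖z‖) (hSub : ∀ z, ‖S z‖ ≤ lhn * ‖z‖) {X X' e e' q' g w : E}
    (heq : g + c • L q' + c • S (X' - X) + w - c • L (e' - e) = 0)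
    (hg : ‖g‖ ≤ ℓ * ‖X'‖) (hw : ‖w‖ ≤ 2 * ℓ * ‖X' - X‖) :
    ‖c • L q'‖ ^ 2 ≤ 4 * ℓ ^ 2 * ‖X'‖ ^ 2
      + 8 * (c ^ 2 * lhn ^ 2 + 4 * ℓ ^ 2) * ‖X' - X‖ ^ 2
      + 4 * (c ^ 2 * lamn ^ 2) * (‖e'‖ ^ 2 + ‖e‖ ^ 2) := by
  have h1 : ‖c • L q'‖ ≤ ℓ * ‖X'‖ + c * (lhn * ‖X' - X‖)
      + 2 * ℓ * ‖X' - X‖ + c * (lamn * (‖e'‖ + ‖e‖)) := by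
    have : c • L q' = -g - c • S (X' - X) - w + c • L (e' - e) := by
      rw [← sub_eq_zero, ← heq]; abel
    rw [this]
    refine (norm_add_le _ _).trans (add_le_add ((norm_sub_le _ _).trans (add_le_add
      ((norm_sub_le _ _).trans (add_le_add ?_ ?_)) hw)) ?_)
    · rwa [norm_neg]
    · rw [norm_smul, Real.norm_of_nonneg hc]; gcongr; exact hSub _
    · rw [norm_smul, Real.norm_of_nonneg hc]; gcongr
      exact (hLub _).trans (mul_le_mul_of_nonneg_left (norm_sub_le _ _) hlamn)
  refine (pow_le_pow_left₀ (norm_nonneg _) h1 2).trans ((sq_add_add_add_le _ _ _ _).trans ?_)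
  have h2 : 0 ≤ c ^ 2 * lamn ^ 2 * (‖e'‖ - ‖e‖) ^ 2 := by positivity
  linarith

/-- Linear convergence of an inexact primal-dual iteration driven by symmetric operators `L`
(positive semidefinite, with a spectral gap) and `S` (positive definite). -/
theorem primal_dual_linear_convergence {E : Type*} [NormedAddCommGroup E] [InnerProductSpace ℝ E]
    {L S : E →ₗ[ℝ] E} (hL : L.IsSymmetric) (hS : S.IsSymmetric)
    {lam2 lamn lh1 lhn : ℝ} (hlam2 : 0 < lam2) (hlamn : 0 ≤ lamn) (hlh1 : 0 < lh1)
    (hlhn : 0 ≤ lhn)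
    (hLpos : ∀ z, 0 ≤ ⟪z, L z⟫) (hLgap : ∀ z, lam2 * ⟪z, L z⟫ ≤ ‖L z‖ ^ 2)
    (hLub : ∀ z, ‖L z‖ ≤ lamn * ‖z‖) (hSlb : ∀ z, lh1 * ‖z‖ ^ 2 ≤ ⟪z, S z⟫)
    (hSub : ∀ z, ‖S z‖ ≤ lhn * ‖z‖)
    {c v ℓ δ m θ : ℝ} (hc : 0 < c) (hδ0 : 0 ≤ δ) (hδ1 : δ < 1)
    (hm : 0 < m) (hθ : 0 < θ) (ha : 0 < v - ℓ ^ 2 / (2 * m))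
    (hG : δ / (1 - √δ) ^ 2 * (2 * m + 2 * θ + c ^ 2 * lamn ^ 2 / m) <
      c * lh1 / 2 - ℓ ^ 2 / (v - ℓ ^ 2 / (2 * m)) - (c ^ 2 * lhn ^ 2 + 4 * ℓ ^ 2) / m)
    {X e q g w : ℕ → E} (hq : ∀ k, q (k + 1) = q k + X (k + 1) + e (k + 1))
    (heq : ∀ k, g k + c • L (q (k + 1)) + c • S (X (k + 1) - X k) + w k
      - c • L (e (k + 1) - e k) = 0)
    (hmono : ∀ k, v * ‖X (k + 1)‖ ^ 2 ≤ ⟪g k, X (k + 1)⟫)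
    (hg : ∀ k, ‖g k‖ ≤ ℓ * ‖X (k + 1)‖)
    (hw : ∀ k, ‖w k‖ ≤ 2 * ℓ * ‖X (k + 1) - X k‖)
    (he : ∀ k, ‖e (k + 1)‖ ^ 2 ≤ δ * ‖X (k + 1) - X k - e k‖ ^ 2) :
    ∃ σ C₀ : ℝ, 0 < σ ∧ σ < 1 ∧ 0 ≤ C₀ ∧ ∀ k, ‖X k‖ ≤ C₀ * σ ^ k := by
  set a := v - ℓ ^ 2 / (2 * m) with ha_def
  set s := √δ with hs
  have hs0 : 0 ≤ s := Real.sqrt_nonneg _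
  have hss : s ^ 2 = δ := Real.sq_sqrt hδ0
  have hs1 : s < 1 := by nlinarith
  set F := c ^ 2 * lamn ^ 2 / m with hF
  have hF0 : 0 ≤ F := by positivity
  set R := (c ^ 2 * lhn ^ 2 + 4 * ℓ ^ 2) / m with hR
  have hR0 : 0 ≤ R := by positivity
  obtain ⟨M, hM0, hM⟩ := exists_error_weight (A := 2 * m + F / 2 + θ) (B := F / 2 + θ) hs0 hs1
    (by positivity) (by positivity)
  obtain ⟨η, hη, hcoer⟩ := exists_coercive_bound ℓ ha (sub_pos.2 hG)
  have hP := fun k => dual_residual_le hc.le hlamn hLub hSub (heq k) (hg k) (hw k)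
  set W : ℕ → ℝ := fun k => c / 2 * ⟪q k, L (q k)⟫ + c / 2 * ⟪X k, S (X k)⟫
    + c / 2 * ⟪e k, L (e k)⟫ + M * ‖e k‖ ^ 2 with hW
  have hdec : ∀ k, W (k + 1) ≤ W k - η * (‖X (k + 1)‖ ^ 2 + ‖X (k + 1) - X k‖ ^ 2)
      - θ * (‖e (k + 1)‖ ^ 2 + ‖e k‖ ^ 2) := fun k => by
    have h1 := primal_dual_energy_step hL hS hLpos hc (hq k) (heq k)
    have h2 : -⟪w k, X (k + 1)⟫ ≤ 2 * ℓ * ‖X (k + 1)‖ * ‖X (k + 1) - X k‖ := by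
      have := (abs_real_inner_le_norm (w k) (X (k + 1))).trans
        (mul_le_mul_of_nonneg_right (hw k) (norm_nonneg _))
      linarith [neg_abs_le ⟪w k, X (k + 1)⟫]
    have h3 : ⟪c • L (q (k + 1)), e (k + 1)⟫
        ≤ ‖c • L (q (k + 1))‖ ^ 2 / (8 * m) + 2 * m * ‖e (k + 1)‖ ^ 2 := by
      refine (real_inner_le_norm _ _).trans ?_
      have : ‖c • L (q (k + 1))‖ ^ 2 / (8 * m) + 2 * m * ‖e (k + 1)‖ ^ 2
          - ‖c • L (q (k + 1))‖ * ‖e (k + 1)‖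
          = (‖c • L (q (k + 1))‖ - 4 * m * ‖e (k + 1)‖) ^ 2 / (8 * m) := by
        field_simp; ring
      have : 0 ≤ (‖c • L (q (k + 1))‖ - 4 * m * ‖e (k + 1)‖) ^ 2 / (8 * m) := by positivity
      linarith
    have h4 : ‖c • L (q (k + 1))‖ ^ 2 / (8 * m) ≤ ℓ ^ 2 / (2 * m) * ‖X (k + 1)‖ ^ 2
        + R * ‖X (k + 1) - X k‖ ^ 2 + F / 2 * (‖e (k + 1)‖ ^ 2 + ‖e k‖ ^ 2) := by
      rw [div_le_iff₀ (by positivity)]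
      refine (hP k).trans (le_of_eq ?_)
      rw [hR, hF]; field_simp; ring
    have h5 := hM ‖e k‖ ‖e (k + 1)‖ ‖X (k + 1) - X k‖ (by
      rw [hss]
      refine (he k).trans ?_
      gcongr
      exact norm_sub_le _ _)
    have h6 := hcoer ‖X (k + 1)‖ ‖X (k + 1) - X k‖
    have h7 := mul_le_mul_of_nonneg_left (hSlb (X (k + 1) - X k)) (half_pos hc).le
    have h8 := hmono k
    have h9 : v * ‖X (k + 1)‖ ^ 2 = a * ‖X (k + 1)‖ ^ 2 + ℓ ^ 2 / (2 * m) * ‖X (k + 1)‖ ^ 2 := by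
      rw [ha_def]; ring
    rw [hss] at h5
    simp only [hW]
    linarith
  -- the Lyapunov function is dominated by the decrease
  obtain ⟨K, hK, hdom⟩ : ∃ K > 0, ∀ k, W (k + 1) ≤ K * (η * (‖X (k + 1)‖ ^ 2
      + ‖X (k + 1) - X k‖ ^ 2) + θ * (‖e (k + 1)‖ ^ 2 + ‖e k‖ ^ 2)) := by
    have hi : 0 ≤ 1 / (2 * lam2 * c) := by positivity
    set K₁ := 1 / (2 * lam2 * c) * (4 * ℓ ^ 2) + c / 2 * lhn
    set K₂ := 1 / (2 * lam2 * c) * (8 * (c ^ 2 * lhn ^ 2 + 4 * ℓ ^ 2))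
    set K₃ := 1 / (2 * lam2 * c) * (4 * (c ^ 2 * lamn ^ 2)) + c / 2 * lamn + M
    obtain ⟨K, hK, hKle⟩ := exists_dominating_const (K₁ := K₁) (K₂ := K₂) (K₃ := K₃)
      (by positivity) (by positivity) (by positivity) hη hθ
    refine ⟨K, hK, fun k => ?_⟩
    have h1 : c / 2 * ⟪q (k + 1), L (q (k + 1))⟫
        ≤ 1 / (2 * lam2 * c) * ‖c • L (q (k + 1))‖ ^ 2 := by
      rw [norm_smul, Real.norm_of_nonneg hc.le]
      have e1 : 1 / (2 * lam2 * c) * (c * ‖L (q (k + 1))‖) ^ 2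
          = c / 2 * (‖L (q (k + 1))‖ ^ 2 / lam2) := by field_simp
      rw [e1]
      gcongr
      rw [le_div_iff₀ hlam2]
      linarith [hLgap (q (k + 1))]
    have h2 := mul_le_mul_of_nonneg_left (hP k) hi
    have h3 : ⟪X (k + 1), S (X (k + 1))⟫ ≤ lhn * ‖X (k + 1)‖ ^ 2 := by
      refine (real_inner_le_norm _ _).trans ?_
      nlinarith [mul_le_mul_of_nonneg_left (hSub (X (k + 1))) (norm_nonneg (X (k + 1)))]
    have h4 : ⟪e (k + 1), L (e (k + 1))⟫ ≤ lamn * ‖e (k + 1)‖ ^ 2 := by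
      refine (real_inner_le_norm _ _).trans ?_
      nlinarith [mul_le_mul_of_nonneg_left (hLub (e (k + 1))) (norm_nonneg (e (k + 1)))]
    have h3' := mul_le_mul_of_nonneg_left h3 (half_pos hc).le
    have h4' := mul_le_mul_of_nonneg_left h4 (half_pos hc).le
    have h5 : W (k + 1) ≤ K₁ * ‖X (k + 1)‖ ^ 2 + K₂ * ‖X (k + 1) - X k‖ ^ 2
        + K₃ * (‖e (k + 1)‖ ^ 2 + ‖e k‖ ^ 2) := by
      have : 0 ≤ (c / 2 * lamn + M) * ‖e k‖ ^ 2 := by positivity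
      simp only [hW, K₁, K₂, K₃]
      linarith
    exact h5.trans (hKle _ _ _ (by positivity) (by positivity) (by positivity))
  have hr : 0 < K⁻¹ := inv_pos.2 hK
  have hgeo := le_mul_inv_pow_of_succ_le (W := W) hr fun k => by
    have h1 := mul_le_mul_of_nonneg_left (hdom k) hr.le
    rw [inv_mul_cancel_left₀ hK.ne'] at h1
    linarith [hdec k]
  have hlow : ∀ k, c / 2 * lh1 * ‖X k‖ ^ 2 ≤ W k := fun k => by
    have h1 := mul_le_mul_of_nonneg_left (hSlb (X k)) (half_pos hc).le
    have h2 := mul_nonneg (half_pos hc).le (hLpos (q k))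
    have h3 := mul_nonneg (half_pos hc).le (hLpos (e k))
    have h4 : 0 ≤ M * ‖e k‖ ^ 2 := by positivity
    simp only [hW]
    linarith
  have hcl : 0 < c / 2 * lh1 := by positivity
  have hW0 : 0 ≤ W 0 := le_trans (by positivity) (hlow 0)
  set ρ := (1 + K⁻¹)⁻¹ with hρ
  have hρ0 : 0 < ρ := by positivity
  have hρ1 : ρ < 1 := inv_lt_one_of_one_lt₀ (by linarith)
  refine ⟨√ρ, √(W 0 / (c / 2 * lh1)), Real.sqrt_pos.2 hρ0, ?_, Real.sqrt_nonneg _, fun k => ?_⟩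
  · rw [Real.sqrt_lt' one_pos]; simpa using hρ1
  · refine abs_le_of_sq_le_sq' ?_ (by positivity) |>.2
    rw [mul_pow, ← pow_mul, mul_comm k 2, pow_mul, Real.sq_sqrt (by positivity),
      Real.sq_sqrt hρ0.le, div_mul_eq_mul_div, le_div_iff₀ hcl]
    linarith [hlow k, hgeo k]

theorem inner_fderiv_ge_of_strongly_monotone {F : Type*} [NormedAddCommGroup F]
    [InnerProductSpace ℝ F] {h : F → F} {v : ℝ} (hd : Differentiable ℝ h)
    (hm : ∀ x x', v * ‖x' - x‖ ^ 2 ≤ ⟪h x' - h x, x' - x⟫) (y u : F) :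
    v * ‖u‖ ^ 2 ≤ ⟪fderiv ℝ h y u, u⟫ := by
  have hpath : HasDerivAt (fun t : ℝ => y + t • u) u 0 := by
    simpa using ((hasDerivAt_id (0 : ℝ)).smul_const u).const_add y
  have h1 : HasDerivAt (fun t : ℝ => h (y + t • u)) (fderiv ℝ h y u) 0 := by
    have hy : HasFDerivAt h (fderiv ℝ h y) (y + (0 : ℝ) • u) := by simpa using (hd y).hasFDerivAt
    exact hy.comp_hasDerivAt 0 hpath
  have h2 : HasDerivAt (fun t : ℝ => ⟪h (y + t • u), u⟫ - v * ‖u‖ ^ 2 * t)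
      (⟪fderiv ℝ h y u, u⟫ - v * ‖u‖ ^ 2) 0 := by
    have h3 := (h1.inner ℝ (hasDerivAt_const 0 u)).fun_sub
      ((hasDerivAt_id' (0 : ℝ)).const_mul (v * ‖u‖ ^ 2))
    rwa [inner_zero_right, zero_add, mul_one] at h3
  have hmon : Monotone (fun t : ℝ => ⟪h (y + t • u), u⟫ - v * ‖u‖ ^ 2 * t) := by
    intro s t hst
    rcases hst.eq_or_lt with rfl | hlt
    · rfl
    have := hm (y + s • u) (y + t • u)
    have e : y + t • u - (y + s • u) = (t - s) • u := by rw [sub_smul]; abel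
    rw [e, norm_smul, real_inner_smul_right, inner_sub_left, mul_pow, Real.norm_eq_abs, sq_abs]
      at this
    have h3 : v * ‖u‖ ^ 2 * (t - s) ≤ ⟪h (y + t • u), u⟫ - ⟪h (y + s • u), u⟫ := by
      refine le_of_mul_le_mul_left ?_ (sub_pos.2 hlt)
      linarith
    simp only
    linarith
  have := hmon.deriv_nonneg (x := 0)
  rw [h2.deriv] at this
  linarith

theorem ContinuousLinearMap.isUnit_of_coercive {F : Type*} [NormedAddCommGroup F]
    [InnerProductSpace ℝ F] [FiniteDimensional ℝ F] {T : F →L[ℝ] F} {v : ℝ} (hv : 0 < v)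
    (hT : ∀ u, v * ‖u‖ ^ 2 ≤ ⟪T u, u⟫) : IsUnit T := by
  have := FiniteDimensional.complete ℝ F
  have hinj : Function.Injective (T : F →ₗ[ℝ] F) := by
    rw [injective_iff_map_eq_zero]
    intro u hu
    have h1 := hT u
    rw [show T u = 0 from hu, inner_zero_left] at h1
    have : ‖u‖ ^ 2 = 0 := le_antisymm (nonpos_of_mul_nonpos_right h1 hv) (sq_nonneg _)
    simpa using this
  rw [ContinuousLinearMap.isUnit_iff_bijective]
  exact ⟨hinj, LinearMap.injective_iff_surjective.1 hinj⟩

theorem ContDiff.differentiable_gradient {F : Type*} [NormedAddCommGroup F]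
    [InnerProductSpace ℝ F] [CompleteSpace F] {f : F → ℝ} (hf : ContDiff ℝ 2 f) :
    Differentiable ℝ (gradient f) := by
  have h1 : Differentiable ℝ (fderiv ℝ f) :=
    (hf.fderiv_right (m := 1) (by norm_num)).differentiable (by norm_num)
  exact (InnerProductSpace.toDual ℝ F).symm.toContinuousLinearEquiv.differentiable.comp h1

theorem sum_gradient_eq_zero_of_forall_le {ι F : Type*} [Fintype ι] [NormedAddCommGroup F]
    [InnerProductSpace ℝ F] [CompleteSpace F] {f : ι → F → ℝ} (hf : ∀ i, Differentiable ℝ (f i))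
    {p : F} (hp : ∀ z, ∑ i, f i p ≤ ∑ i, f i z) : ∑ i, gradient (f i) p = 0 := by
  have h1 : fderiv ℝ (fun z => ∑ i, f i z) p = 0 :=
    IsLocalMin.fderiv_eq_zero (Filter.Eventually.of_forall hp)
  rw [fderiv_fun_sum fun i _ => (hf i) p] at h1
  simp only [gradient, ← map_sum, h1, map_zero]

/-- The operator `A ⊗ I_d` on stacked vectors, with the Euclidean structure. -/
def stackedOp {n : ℕ} (d : ℕ) (A : Matrix (Fin n) (Fin n) ℝ) :
    PiLp 2 (fun _ : Fin n => EuclideanSpace ℝ (Fin d)) →ₗ[ℝ]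
      PiLp 2 (fun _ : Fin n => EuclideanSpace ℝ (Fin d)) where
  toFun z := WithLp.toLp 2 (blockMul A z)
  map_add' z w := by
    ext1 i
    simp [blockMul, Finset.sum_add_distrib]
  map_smul' r z := by
    ext1 i
    simp [blockMul, Finset.smul_sum, smul_comm r]

theorem stackedOp_apply {n d : ℕ} (A : Matrix (Fin n) (Fin n) ℝ)
    (z : PiLp 2 (fun _ : Fin n => EuclideanSpace ℝ (Fin d))) (i : Fin n) :
    stackedOp d A z i = ∑ j, A i j • z j := rfl

theorem stackedOp_isSymmetric {n d : ℕ} {A : Matrix (Fin n) (Fin n) ℝ} (hA : A.IsSymm) :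
    (stackedOp d A).IsSymmetric := by
  intro z w
  rw [PiLp.inner_apply, PiLp.inner_apply]
  simp_rw [stackedOp_apply, sum_inner, inner_sum]
  rw [Finset.sum_comm]
  exact Finset.sum_congr rfl fun i _ => Finset.sum_congr rfl fun j _ => by
    rw [real_inner_smul_left, real_inner_smul_right, hA.apply]

theorem isEigenvalue_of_hasEigenvalue_stackedOp {n d : ℕ} {A : Matrix (Fin n) (Fin n) ℝ} {t : ℝ}
    (h : Module.End.HasEigenvalue (stackedOp d A) t) : IsEigenvalue A t := by
  obtain ⟨z, hz⟩ := h.exists_hasEigenvector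
  have hz1 : stackedOp d A z = t • z := hz.apply_eq_smul
  obtain ⟨j, hj⟩ : ∃ j, (fun i => z i j) ≠ 0 := by
    by_contra! hall
    refine hz.2 ?_
    ext i j
    exact congrFun (hall j) i
  refine ⟨_, hj, ?_⟩
  ext i
  have h1 := congrArg (fun w => w i j) hz1
  simpa [stackedOp_apply, Matrix.mulVec, dotProduct] using h1

theorem mul_sq_norm_le_inner_stackedOp {n d : ℕ} {A : Matrix (Fin n) (Fin n) ℝ} (hA : A.IsSymm)
    {lo : ℝ} (h : ∀ t, IsEigenvalue A t → lo ≤ t)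
    (z : PiLp 2 (fun _ : Fin n => EuclideanSpace ℝ (Fin d))) :
    lo * ‖z‖ ^ 2 ≤ ⟪z, stackedOp d A z⟫ := by
  have := (stackedOp_isSymmetric (d := d) hA).quadratic_form_nonneg (a := 0) (b := 1) (g := -lo)
    (fun t ht => by linarith [h t (isEigenvalue_of_hasEigenvalue_stackedOp ht)]) z
  linarith

theorem norm_stackedOp_le {n d : ℕ} {A : Matrix (Fin n) (Fin n) ℝ} (hA : A.IsSymm)
    {hi : ℝ} (h0 : 0 ≤ hi) (h : ∀ t, IsEigenvalue A t → 0 ≤ t ∧ t ≤ hi)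
    (z : PiLp 2 (fun _ : Fin n => EuclideanSpace ℝ (Fin d))) :
    ‖stackedOp d A z‖ ≤ hi * ‖z‖ := by
  have := (stackedOp_isSymmetric (d := d) hA).quadratic_form_nonneg (a := -1) (b := 0)
    (g := hi ^ 2) (fun t ht => by
      obtain ⟨h1, h2⟩ := h t (isEigenvalue_of_hasEigenvalue_stackedOp ht)
      nlinarith) z
  refine abs_le_of_sq_le_sq' ?_ (by positivity) |>.2
  linarith

theorem gap_mul_inner_stackedOp_le {n d : ℕ} {A : Matrix (Fin n) (Fin n) ℝ} (hA : A.IsSymm)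
    {gap : ℝ} (h : ∀ t, IsEigenvalue A t → 0 ≤ t ∧ (0 < t → gap ≤ t))
    (z : PiLp 2 (fun _ : Fin n => EuclideanSpace ℝ (Fin d))) :
    gap * ⟪z, stackedOp d A z⟫ ≤ ‖stackedOp d A z‖ ^ 2 := by
  have := (stackedOp_isSymmetric (d := d) hA).quadratic_form_nonneg (a := 1) (b := -gap)
    (g := 0) (fun t ht => by
      obtain ⟨h1, h2⟩ := h t (isEigenvalue_of_hasEigenvalue_stackedOp ht)
      rcases h1.eq_or_lt with rfl | h3
      · simp
      · nlinarith [mul_nonneg h1 (sub_nonneg.2 (h2 h3))]) z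
  linarith

theorem IsEigenvalue.nonneg_of_posSemidef {n : ℕ} {A : Matrix (Fin n) (Fin n) ℝ}
    (hA : A.PosSemidef) {t : ℝ} (ht : IsEigenvalue A t) : 0 ≤ t := by
  obtain ⟨z, hz, hAz⟩ := ht
  have h1 := hA.dotProduct_mulVec_nonneg z
  rw [hAz, dotProduct_smul, smul_eq_mul] at h1
  have h2 : 0 < star z ⬝ᵥ z := by
    rw [Matrix.dotProduct_star_self_pos_iff]
    exact hz
  exact nonneg_of_mul_nonneg_left h1 h2

theorem IsEigenvalue.pos_of_posDef {n : ℕ} {A : Matrix (Fin n) (Fin n) ℝ}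
    (hA : A.PosDef) {t : ℝ} (ht : IsEigenvalue A t) : 0 < t := by
  obtain ⟨z, hz, hAz⟩ := ht
  have h1 := hA.dotProduct_mulVec_pos hz
  rw [hAz, dotProduct_smul, smul_eq_mul] at h1
  have h2 : 0 < star z ⬝ᵥ z := by
    rw [Matrix.dotProduct_star_self_pos_iff]
    exact hz
  exact pos_of_mul_pos_left h1 h2.le

section Laplacians

variable {n d : ℕ} (G : SimpleGraph (Fin n)) [DecidableRel G.Adj]

theorem signedLap_eq_lapMatrix : signedLap G = G.lapMatrix ℝ := rfl

theorem signedLap_isSymm : (signedLap G).IsSymm := G.isSymm_lapMatrix (R := ℝ)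

theorem unsignedLap_isSymm : (unsignedLap G).IsSymm :=
  (Matrix.isSymm_diagonal _).add G.isSymm_adjMatrix

theorem sum_adjMatrix_smul (z : Fin n → EuclideanSpace ℝ (Fin d)) (i : Fin n) :
    ∑ j, G.adjMatrix ℝ i j • z j = ∑ j ∈ G.neighborFinset i, z j := by
  simp [SimpleGraph.adjMatrix_apply, SimpleGraph.neighborFinset_eq_filter, Finset.sum_filter]

theorem stackedOp_signedLap_apply (z : PiLp 2 (fun _ : Fin n => EuclideanSpace ℝ (Fin d)))
    (i : Fin n) :
    stackedOp d (signedLap G) z i = (G.degree i : ℝ) • z i - ∑ j ∈ G.neighborFinset i, z j := by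
  simp [stackedOp_apply, signedLap, sub_smul, Finset.sum_sub_distrib, Matrix.diagonal_apply,
    ← sum_adjMatrix_smul]

theorem stackedOp_unsignedLap_apply (z : PiLp 2 (fun _ : Fin n => EuclideanSpace ℝ (Fin d)))
    (i : Fin n) :
    stackedOp d (unsignedLap G) z i = (G.degree i : ℝ) • z i + ∑ j ∈ G.neighborFinset i, z j := by
  simp [stackedOp_apply, unsignedLap, add_smul, Finset.sum_add_distrib, Matrix.diagonal_apply,
    ← sum_adjMatrix_smul]

theorem sum_sub_eq_stackedOp_signedLap (z : PiLp 2 (fun _ : Fin n => EuclideanSpace ℝ (Fin d)))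
    (i : Fin n) :
    ∑ j ∈ G.neighborFinset i, (z i - z j) = stackedOp d (signedLap G) z i := by
  rw [stackedOp_signedLap_apply, Finset.sum_sub_distrib, Finset.sum_const,
    SimpleGraph.card_neighborFinset_eq_degree, Nat.cast_smul_eq_nsmul]

variable {G}

theorem eq_of_stackedOp_signedLap_eq_zero (hconn : G.Connected)
    {z : PiLp 2 (fun _ : Fin n => EuclideanSpace ℝ (Fin d))}
    (hz : stackedOp d (signedLap G) z = 0) (i j : Fin n) : z i = z j := by
  ext l
  have h1 : (G.lapMatrix ℝ).mulVec (fun i => z i l) = 0 := by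
    ext i
    have := congrArg (fun w => w i l) hz
    simpa [stackedOp_apply, Matrix.mulVec, dotProduct, signedLap_eq_lapMatrix] using this
  exact G.lapMatrix_mulVec_eq_zero_iff_forall_reachable.1 h1 i j (hconn.preconnected i j)

/-- On a connected graph, a stacked vector whose blocks sum to zero is in the range of `L`. -/
theorem exists_stackedOp_signedLap_eq (hconn : G.Connected)
    {p : PiLp 2 (fun _ : Fin n => EuclideanSpace ℝ (Fin d))} (hp : ∑ i, p i = 0) :
    ∃ z, stackedOp d (signedLap G) z = p := by
  have hsym := stackedOp_isSymmetric (d := d) (signedLap_isSymm G)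
  change p ∈ LinearMap.range (stackedOp d (signedLap G))
  rw [← Submodule.orthogonal_orthogonal (LinearMap.range (stackedOp d (signedLap G))),
    hsym.orthogonal_range, Submodule.mem_orthogonal]
  intro w hw
  obtain ⟨i₀⟩ := hconn.nonempty
  rw [PiLp.inner_apply]
  have h1 : ∀ i, ⟪w i, p i⟫ = ⟪w i₀, p i⟫ := fun i => by
    rw [eq_of_stackedOp_signedLap_eq_zero hconn (LinearMap.mem_ker.1 hw) i i₀]
  simp only [h1, ← inner_sum, hp, inner_zero_right]

theorem stackedOp_signedLap_const (u : EuclideanSpace ℝ (Fin d)) :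
    stackedOp d (signedLap G) (WithLp.toLp 2 fun _ => u) = 0 := by
  ext1 i
  rw [← sum_sub_eq_stackedOp_signedLap]
  simp

end Laplacians

/-- One CC-DQM primal step satisfies the linear system defining it. -/
theorem ringInverse_step {F : Type*} [NormedAddCommGroup F] [InnerProductSpace ℝ F]
    {T : F →L[ℝ] F} (hT : IsUnit T) {x x' b : F} (h : x' = x - Ring.inverse T b) :
    T (x' - x) + b = 0 := by
  have h1 : T (Ring.inverse T b) = b := by
    rw [← mul_apply_eq_comp, Ring.mul_inverse_cancel T hT,
      one_apply_eq_self]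
  rw [h, sub_sub_cancel_left, map_neg, h1, neg_add_cancel]

/-- The parameter condition, rewritten in terms of `m = c β lam2` and `θ = c lamn`. -/
theorem parameter_condition {lam2 lamn lh1 lhn c v ℓ β κ : ℝ} (hc : 0 < c) (hv : 0 < v)
    (hlam2 : 0 < lam2) (hle : lam2 ≤ lamn) (hκ : 0 ≤ κ)
    (hβ : ℓ ^ 2 / (2 * c * lam2 * v) < β)
    (h : κ < (c * lh1 / 2 - 2 * c * β * lam2 * ℓ ^ 2 / (2 * c * β * lam2 * v - ℓ ^ 2)
          - (c ^ 2 * lhn ^ 2 + 4 * ℓ ^ 2) / (c * β * lam2)) /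
        (3 * c * lamn + 2 * c * β * lamn + c * lamn ^ 2 / (β * lam2))) :
    0 < c * β * lam2 ∧ 0 < v - ℓ ^ 2 / (2 * (c * β * lam2)) ∧
      κ * (2 * (c * β * lam2) + 2 * (c * lamn) + c ^ 2 * lamn ^ 2 / (c * β * lam2)) <
        c * lh1 / 2 - ℓ ^ 2 / (v - ℓ ^ 2 / (2 * (c * β * lam2)))
          - (c ^ 2 * lhn ^ 2 + 4 * ℓ ^ 2) / (c * β * lam2) := by
  have hβ0 : 0 < β := lt_of_le_of_lt (by positivity) hβ
  have hlamn : 0 < lamn := hlam2.trans_le hle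
  have hm : 0 < c * β * lam2 := by positivity
  rw [div_lt_iff₀ (by positivity)] at hβ
  have ha : 0 < v - ℓ ^ 2 / (2 * (c * β * lam2)) := by
    rw [sub_pos, div_lt_iff₀ (by positivity)]
    linarith
  refine ⟨hm, ha, ?_⟩
  rw [lt_div_iff₀ (by positivity)] at h
  have e1 : 2 * c * β * lam2 * ℓ ^ 2 / (2 * c * β * lam2 * v - ℓ ^ 2)
      = ℓ ^ 2 / (v - ℓ ^ 2 / (2 * (c * β * lam2))) := by
    have : 2 * c * β * lam2 * v - ℓ ^ 2 ≠ 0 := by linarith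
    rw [div_eq_div_iff this ha.ne']
    field_simp
  rw [e1] at h
  refine lt_of_le_of_lt (mul_le_mul_of_nonneg_left ?_ hκ) h
  have e2 : c ^ 2 * lamn ^ 2 / (c * β * lam2) = c * lamn ^ 2 / (β * lam2) := by field_simp
  have h2 := mul_le_mul_of_nonneg_left hle hm.le
  have h3 : c * β * lam2 ≤ c * β * lamn := by gcongr
  rw [e2]
  nlinarith [mul_pos hc hlamn]

/-- **Theorem 1** (exact linear convergence of CC-DQM without censoring).
If the thresholds are all zero and the parameters `c, δ` satisfy the parameter condition,
then the stacked CC-DQM iterates converge to the consensus optimum at a linear rate. -/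
theorem ccdqm_linear_convergence_no_censoring
    {n d : ℕ} (G : SimpleGraph (Fin n)) [DecidableRel G.Adj] (hconn : G.Connected)
    (f : Fin n → EuclideanSpace ℝ (Fin d) → ℝ)
    (vi li : Fin n → ℝ) (v ℓ : ℝ)
    (hf : ∀ i, ContDiff ℝ 2 (f i))
    (hvi : ∀ i, 0 < vi i)
    (hsc : ∀ i x x', vi i * ‖x' - x‖ ^ 2 ≤ ⟪gradient (f i) x' - gradient (f i) x, x' - x⟫)
    (hlip : ∀ i x x', ‖gradient (f i) x' - gradient (f i) x‖ ≤ li i * ‖x' - x‖)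
    (hv : IsLeast (Set.range vi) v) (hℓ : IsGreatest (Set.range li) ℓ)
    (lam2 lamn lh1 lhn : ℝ)
    (hlam2 : IsEigenvalue (signedLap G) lam2 ∧ 0 < lam2 ∧
      ∀ t, IsEigenvalue (signedLap G) t → 0 < t → lam2 ≤ t)
    (hlamn : IsEigenvalue (signedLap G) lamn ∧ ∀ t, IsEigenvalue (signedLap G) t → t ≤ lamn)
    (hlh1 : IsEigenvalue (unsignedLap G) lh1 ∧ ∀ t, IsEigenvalue (unsignedLap G) t → lh1 ≤ t)
    (hlhn : IsEigenvalue (unsignedLap G) lhn ∧ ∀ t, IsEigenvalue (unsignedLap G) t → t ≤ lhn)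
    (hposdef : (unsignedLap G).PosDef)
    (c δ : ℝ) (hc : 0 < c) (hδ0 : 0 ≤ δ) (hδ1 : δ < 1)
    (C : EuclideanSpace ℝ (Fin d) → EuclideanSpace ℝ (Fin d))
    (hC : ∀ z, ‖C z - z‖ ^ 2 ≤ δ * ‖z‖ ^ 2)
    (μ : ℕ → ℝ) (hμ : ∀ k, μ k = 0)
    (x y φ : ℕ → Fin n → EuclideanSpace ℝ (Fin d))
    (halg : IsCCDQM G f c μ C x y φ)
    (xstar : EuclideanSpace ℝ (Fin d))
    (hxstar : ∀ z, ∑ i, f i xstar ≤ ∑ i, f i z)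
    (hparam : ∃ β : ℝ, ℓ ^ 2 / (2 * c * lam2 * v) < β ∧
      0 < c * lh1 / 2 - 2 * c * β * lam2 * ℓ ^ 2 / (2 * c * β * lam2 * v - ℓ ^ 2)
          - (c ^ 2 * lhn ^ 2 + 4 * ℓ ^ 2) / (c * β * lam2) ∧
      δ / (1 - Real.sqrt δ) ^ 2 <
        (c * lh1 / 2 - 2 * c * β * lam2 * ℓ ^ 2 / (2 * c * β * lam2 * v - ℓ ^ 2)
          - (c ^ 2 * lhn ^ 2 + 4 * ℓ ^ 2) / (c * β * lam2)) /
        (3 * c * lamn + 2 * c * β * lamn + c * lamn ^ 2 / (β * lam2))) :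
    ∃ σ C₀ : ℝ, 0 < σ ∧ σ < 1 ∧ 0 ≤ C₀ ∧
      ∀ k : ℕ, Real.sqrt (∑ i, ‖x k i - xstar‖ ^ 2) ≤ C₀ * σ ^ k := by
  rcases subsingleton_or_nontrivial (EuclideanSpace ℝ (Fin d)) with hsub | hnon
  · refine ⟨1 / 2, 0, by norm_num, by norm_num, le_rfl, fun k => ?_⟩
    simp [Subsingleton.elim (_ - xstar) 0]
  obtain ⟨⟨i₀, hi₀⟩, hvle⟩ := hv
  have hv0 : 0 < v := hi₀ ▸ hvi i₀
  have hvle' : ∀ i, v ≤ vi i := fun i => hvle ⟨i, rfl⟩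
  have hlile : ∀ i, li i ≤ ℓ := fun i => hℓ.2 ⟨i, rfl⟩
  have hli0 : ∀ i, 0 ≤ li i := fun i => by
    obtain ⟨u, hu⟩ := exists_ne (0 : EuclideanSpace ℝ (Fin d))
    have := (norm_nonneg _).trans (hlip i 0 u)
    rw [sub_zero] at this
    exact nonneg_of_mul_nonneg_left this (norm_pos_iff.2 hu)
  have hℓ0 : 0 ≤ ℓ := (hli0 i₀).trans (hlile i₀)
  have hdiff : ∀ i, Differentiable ℝ (gradient (f i)) := fun i => (hf i).differentiable_gradient
  have hHess : ∀ i p, ‖fderiv ℝ (gradient (f i)) p‖ ≤ li i := fun i p => by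
    refine norm_fderiv_le_of_lip' ℝ (hli0 i) (Filter.Eventually.of_forall fun z => hlip i p z)
  have hmonH : ∀ i p u, v * ‖u‖ ^ 2 ≤ ⟪fderiv ℝ (gradient (f i)) p u, u⟫ := fun i p u =>
    (mul_le_mul_of_nonneg_right (hvle' i) (sq_nonneg _)).trans
      (inner_fderiv_ge_of_strongly_monotone (hdiff i) (hsc i) p u)
  obtain ⟨-, hφ0, hx, hy, hφ⟩ := halg
  -- spectral facts
  have hLev : ∀ t, IsEigenvalue (signedLap G) t → 0 ≤ t := fun t ht =>
    ht.nonneg_of_posSemidef (G.posSemidef_lapMatrix ℝ)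
  have hlh1 : 0 < lh1 ∧ _ := ⟨hlh1.1.pos_of_posDef hposdef, hlh1.2⟩
  have hlhn0 : 0 ≤ lhn := (hlhn.1.pos_of_posDef hposdef).le
  have hle : lam2 ≤ lamn := hlamn.2 _ hlam2.1
  have hlamn0 : 0 < lamn := hlam2.2.1.trans_le hle
  have hLsym := signedLap_isSymm G
  have hSsym := unsignedLap_isSymm G
  obtain ⟨β, hβ, -, hG⟩ := hparam
  obtain ⟨hm, ha, hG⟩ := parameter_condition hc hv0 hlam2.2.1 hle (by positivity) hβ hG
  -- the iterates as elements of the stacked Euclidean space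
  set L := stackedOp d (signedLap G) with hLdef
  set S := stackedOp d (unsignedLap G) with hSdef
  let stk : (Fin n → EuclideanSpace ℝ (Fin d)) →
      PiLp 2 (fun _ : Fin n => EuclideanSpace ℝ (Fin d)) := WithLp.toLp 2
  have norm_stk_sq : ∀ z : PiLp 2 (fun _ : Fin n => EuclideanSpace ℝ (Fin d)),
      ‖z‖ ^ 2 = ∑ i, ‖z i‖ ^ 2 := fun z => PiLp.norm_sq_eq_of_L2 _ z
  have norm_le : ∀ (z u : PiLp 2 (fun _ : Fin n => EuclideanSpace ℝ (Fin d))) (r : ℝ), 0 ≤ r →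
      (∀ i, ‖z i‖ ≤ r * ‖u i‖) → ‖z‖ ≤ r * ‖u‖ := fun z u r hr h => by
    refine abs_le_of_sq_le_sq' ?_ (by positivity) |>.2
    rw [mul_pow, norm_stk_sq, norm_stk_sq, Finset.mul_sum]
    refine Finset.sum_le_sum fun i _ => ?_
    rw [← mul_pow]
    exact pow_le_pow_left₀ (norm_nonneg _) (h i) 2
  have hgsum : ∑ i, gradient (f i) xstar = 0 :=
    sum_gradient_eq_zero_of_forall_le (fun i => (hf i).differentiable (by norm_num)) hxstar
  obtain ⟨zs, hzs⟩ : ∃ zs, L zs = stk fun i => -(c⁻¹ • gradient (f i) xstar) :=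
    exists_stackedOp_signedLap_eq hconn (by
      simp [stk, Finset.sum_neg_distrib, ← Finset.smul_sum, hgsum])
  obtain ⟨q, hq0, hqs⟩ : ∃ q : ℕ → PiLp 2 (fun _ : Fin n => EuclideanSpace ℝ (Fin d)),
      q 0 = -zs ∧ ∀ k, q (k + 1) = q k + (stk (y (k + 1)) - stk fun _ => xstar) :=
    ⟨fun k => ∑ j ∈ Finset.range k, (stk (y (j + 1)) - stk fun _ => xstar) - zs, by simp,
      fun k => by simp only [Finset.sum_range_succ]; abel⟩
  have hqL : ∀ k i, (c • L (q k)) i = φ k i + gradient (f i) xstar := by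
    intro k
    induction k with
    | zero =>
      intro i
      rw [hq0, map_neg, hzs, hφ0]
      simp [stk, smul_smul, mul_inv_cancel₀ hc.ne']
    | succ k ih =>
      intro i
      have e2 : L (stk fun _ => xstar) = 0 := stackedOp_signedLap_const xstar
      have e3 : ∑ j ∈ G.neighborFinset i, (y (k + 1) i - y (k + 1) j) = L (stk (y (k + 1))) i :=
        sum_sub_eq_stackedOp_signedLap G (stk (y (k + 1))) i
      rw [hqs, map_add, map_sub, e2, sub_zero, smul_add, PiLp.add_apply, ih, hφ, e3,
        PiLp.smul_apply]
      abel
  obtain ⟨σ, C₀, hσ0, hσ1, hC₀, hfin⟩ := primal_dual_linear_convergence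
    (L := L) (S := S) (stackedOp_isSymmetric hLsym) (stackedOp_isSymmetric hSsym)
    hlam2.2.1 hlamn0.le hlh1.1 hlhn0
    (fun z => by simpa using mul_sq_norm_le_inner_stackedOp hLsym hLev z)
    (gap_mul_inner_stackedOp_le hLsym fun t ht => ⟨hLev t ht, hlam2.2.2 t ht⟩)
    (norm_stackedOp_le hLsym hlamn0.le fun t ht => ⟨hLev t ht, hlamn.2 t ht⟩)
    (mul_sq_norm_le_inner_stackedOp hSsym hlh1.2)
    (norm_stackedOp_le hSsym hlhn0 fun t ht => ⟨(ht.pos_of_posDef hposdef).le, hlhn.2 t ht⟩)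
    hc hδ0 hδ1 hm (by positivity) ha hG
    (X := fun k => stk (x k) - stk fun _ => xstar) (e := fun k => stk (y k) - stk (x k)) (q := q)
    (g := fun k => stk fun i => gradient (f i) (x (k + 1) i) - gradient (f i) xstar)
    (w := fun k => stk fun i => gradient (f i) (x k i)
      + fderiv ℝ (gradient (f i)) (y k i) (x (k + 1) i - x k i) - gradient (f i) (x (k + 1) i))
    (fun k => by rw [hqs]; abel)
    (fun k => by
      ext1 i
      have hstep := ringInverse_step (ContinuousLinearMap.isUnit_of_coercive hv0 fun u => by
        have h1 : 0 ≤ 2 * c * (G.degree i : ℝ) * ‖u‖ ^ 2 := by positivity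
        have h2 := hmonH i (y k i) u
        simp only [add_apply, smul_apply, one_apply_eq_self, inner_add_left, real_inner_smul_left,
          real_inner_self_eq_norm_sq]
        linarith) (hx k i)
      have hLy : ∑ j ∈ G.neighborFinset i, (y k i - y k j) = L (stk (y k)) i :=
        sum_sub_eq_stackedOp_signedLap G (stk (y k)) i
      have hLy' : ∑ j ∈ G.neighborFinset i, (y (k + 1) i - y (k + 1) j)
          = L (stk (y (k + 1))) i := sum_sub_eq_stackedOp_signedLap G (stk (y (k + 1))) i
      have hD : ∀ z, (L z) i + (S z) i = (2 * (G.degree i : ℝ)) • z i := fun z => by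
        rw [hLdef, hSdef, stackedOp_signedLap_apply, stackedOp_unsignedLap_apply, two_mul,
          add_smul]
        abel
      set Δ := stk (x (k + 1)) - stk (x k) with hΔ
      have hΔi : x (k + 1) i - x k i = Δ i := rfl
      have hDΔ := eq_sub_of_add_eq' (hD Δ)
      have eX : (stk (x (k + 1)) - stk fun _ => xstar) - (stk (x k) - stk fun _ => xstar) = Δ :=
        sub_sub_sub_cancel_right _ _ _
      have ee : stk (y (k + 1)) - stk (x (k + 1)) - (stk (y k) - stk (x k))
          = stk (y (k + 1)) - stk (y k) - Δ := by rw [hΔ]; abel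
      have eL : (L (stk (y (k + 1)) - stk (y k) - Δ)) i
          = (L (stk (y (k + 1)))) i - (L (stk (y k))) i - (L Δ) i := by
        rw [map_sub, map_sub]
        rfl
      rw [eX, ee]
      change gradient (f i) (x (k + 1) i) - gradient (f i) xstar + (c • L (q (k + 1))) i
          + c • (S Δ) i
          + (gradient (f i) (x k i) + fderiv ℝ (gradient (f i)) (y k i) (x (k + 1) i - x k i)
            - gradient (f i) (x (k + 1) i))
          - c • (L (stk (y (k + 1)) - stk (y k) - Δ)) i = 0
      rw [hLy, hΔi] at hstep
      rw [hqL, hφ, hLy', eL, hDΔ, hΔi, ← hstep]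
      simp only [add_apply, smul_apply, one_apply_eq_self]
      module)
    (fun k => by
      rw [norm_stk_sq, Finset.mul_sum, PiLp.inner_apply]
      refine Finset.sum_le_sum fun i _ => ?_
      exact (mul_le_mul_of_nonneg_right (hvle' i) (sq_nonneg _)).trans (hsc i _ _))
    (fun k => norm_le _ _ _ hℓ0 fun i =>
      (hlip i _ _).trans (mul_le_mul_of_nonneg_right (hlile i) (norm_nonneg _)))
    (fun k => norm_le _ _ _ (by positivity) fun i => by
      have h1 := (fderiv ℝ (gradient (f i)) (y k i)).le_of_opNorm_le
        ((hHess i (y k i)).trans (hlile i)) (x (k + 1) i - x k i)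
      have h2 := (hlip i (x (k + 1) i) (x k i)).trans
        (mul_le_mul_of_nonneg_right (hlile i) (norm_nonneg _))
      rw [norm_sub_rev (x k i)] at h2
      have h3 := norm_add_le (gradient (f i) (x k i) - gradient (f i) (x (k + 1) i))
        (fderiv ℝ (gradient (f i)) (y k i) (x (k + 1) i - x k i))
      simp only [stk, PiLp.sub_apply, sub_sub_sub_cancel_right]
      rw [add_sub_right_comm]
      linarith)
    (fun k => by
      rw [norm_stk_sq, norm_stk_sq, Finset.mul_sum]
      refine Finset.sum_le_sum fun i _ => ?_
      have h1 := hC (x (k + 1) i - y k i)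
      have h2 := hy k i
      rw [hμ, if_pos (norm_nonneg _)] at h2
      have e1 : y (k + 1) i - x (k + 1) i
          = C (x (k + 1) i - y k i) - (x (k + 1) i - y k i) := by rw [h2]; abel
      simp only [stk, PiLp.sub_apply, sub_sub_sub_cancel_right]
      rw [e1]
      refine h1.trans (le_of_eq ?_)
      congr 3)
  refine ⟨σ, C₀, hσ0, hσ1, hC₀, fun k => ?_⟩
  have := hfin k
  rw [PiLp.norm_eq_of_L2] at this
  exact this
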